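/- Let n ≥ 3 and α ∈ (2/n, 1]. There exist constants c > 1 and c̄ > 0, depending only on n and α, such that for all ε > 0, R > 0 and T > 0, writing Ψ(x,t) = C_α ((T − ct)/(|x|² + R²))^{1/α} with C_α^α = 2 n^{α−1}(n − 2/α), there exists a family of smooth functions ū_1^ε, …, ū_{2n}^ε defined on the region S = { (x,t) : ε (|x|²+R²)^{1/2} < c̄ (T − ct), 0 ≤ t < T/c } that is a classical subsolution of the scaled Carleman kinetic system with interaction k_α on S and satisfies (1/(4n)) Ψ ≤ ū_i^ε ≤ (3/(4n)) Ψ on S for every i = 1,…,2n. -/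

import Mathlib

/-- The `2n` velocities: `v_i = e_i` for the first copy of `Fin n` and
`v_{i+n} = −e_i` for the second copy. -/
noncomputable def vel {n : ℕ} : (Fin n ⊕ Fin n) → EuclideanSpace ℝ (Fin n) :=
  Sum.elim (fun i => EuclideanSpace.single i (1 : ℝ))
    (fun i => -EuclideanSpace.single i (1 : ℝ))

open scoped InnerProductSpace

lemma abs_one_add_rpow_sub_one_le {α s : ℝ} (h0 : 0 ≤ α) (h1 : α ≤ 1) (hs : -1 ≤ s) :
    |(1 + s) ^ α - 1| ≤ |s| := by
  rcases le_total 0 s with h | h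
  · have hle : (1 + s) ^ α ≤ 1 + s := by
      simpa using Real.rpow_le_rpow_of_exponent_le (by linarith : 1 ≤ 1 + s) h1
    have hge : 1 ≤ (1 + s) ^ α := Real.one_le_rpow (by linarith) h0
    rw [abs_of_nonneg h, abs_of_nonneg (by linarith)]
    linarith
  · have hle : (1 + s) ^ α ≤ 1 := Real.rpow_le_one (by linarith) (by linarith) h0
    have hge : 1 + s ≤ (1 + s) ^ α :=
      Real.self_le_rpow_of_le_one (by linarith) (by linarith) h1
    rw [abs_of_nonpos h, abs_of_nonpos (by linarith)]
    linarith

/-- Lower bound for the collision sum of a mean-zero perturbation of a constant state. -/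
lemma collision_sum_ge {ι : Type*} [Fintype ι] {α K D : ℝ} {ξ : ι → ℝ} (h0 : 0 ≤ α)
    (h1 : α ≤ 1) (hK : 0 ≤ K) (hsum : ∑ j, ξ j = 0) (hD : ∀ j, ξ j ^ 2 ≤ D)
    (hξ : ∀ j, |K * ξ j| ≤ 1) (i : ι) :
    -(Fintype.card ι * (ξ i + K * D / 2)) ≤
      ∑ j, (1 + K * (ξ i + ξ j) / 2) ^ α * (ξ j - ξ i) := by
  have key : ∀ j, ξ j - ξ i - K * D / 2 ≤
      (1 + K * (ξ i + ξ j) / 2) ^ α * (ξ j - ξ i) := by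
    intro j
    set s := K * (ξ i + ξ j) / 2 with hs
    have hs1 : -1 ≤ s := by
      have := (abs_le.1 (hξ i)).1
      have := (abs_le.1 (hξ j)).1
      linarith
    have hr := abs_one_add_rpow_sub_one_le h0 h1 hs1
    have hprod : |((1 + s) ^ α - 1) * (ξ j - ξ i)| ≤ K * D / 2 := by
      calc |((1 + s) ^ α - 1) * (ξ j - ξ i)|
          ≤ |s| * |ξ j - ξ i| := by rw [abs_mul]; gcongr
        _ = K / 2 * |ξ j ^ 2 - ξ i ^ 2| := by
            have e : s * (ξ j - ξ i) = K / 2 * (ξ j ^ 2 - ξ i ^ 2) := by rw [hs]; ring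
            rw [← abs_mul, e, abs_mul, abs_of_nonneg (by positivity : 0 ≤ K / 2)]
        _ ≤ K / 2 * D := by
            gcongr
            rw [abs_le]
            constructor <;> linarith [hD i, hD j, sq_nonneg (ξ i), sq_nonneg (ξ j)]
        _ = K * D / 2 := by ring
    linarith [(abs_le.1 hprod).1]
  calc -(Fintype.card ι * (ξ i + K * D / 2)) = ∑ j, (ξ j - ξ i - K * D / 2) := by
        simp only [Finset.sum_sub_distrib, hsum, Finset.sum_const, Finset.card_univ,
          nsmul_eq_mul]
        ring
    _ ≤ _ := Finset.sum_le_sum fun j _ => key j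

lemma norm_vel {n : ℕ} (i : Fin n ⊕ Fin n) : ‖vel i‖ = 1 := by
  cases i <;> simp [vel]

lemma sum_inner_vel {n : ℕ} (x : EuclideanSpace ℝ (Fin n)) :
    ∑ i, ⟪vel i, x⟫_ℝ = 0 := by
  simp [vel, Fintype.sum_sum_type]

/-- The scalar inequality left after inserting a state `w (1 + K ξ i)` into the kinetic system. -/
lemma kinetic_residual_nonpos {α c K ε τ ρ ξ w S n : ℝ} (hα : 0 < α) (hα1 : α ≤ 1)
    (hK : 0 < K) (hε : 0 < ε) (hτ : 0 < τ) (hρ : 0 < ρ) (hw : 0 < w) (hn : 0 < n)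
    (hc : 4 * K ≤ c) (hξ : |K * ξ| ≤ 1 / 2)
    (hS : -(2 * n * (ξ + K * (ε ^ 2 * ρ / τ ^ 2) / 2)) ≤ S) :
    w * (-(c / α) / τ * (1 + K * ξ) + K * (c * ξ / τ)) +
      1 / ε * (w * (-(2 / α) * (ξ * τ / ε / ρ) * (1 + K * ξ) + K * (ε / τ))) -
      1 / (2 * n * ε ^ 2) * (2 / (α * K) * (τ / ρ) * (w * K) * S) ≤ 0 := by
  have hcoll : -(1 / (2 * n * ε ^ 2) * (2 / (α * K) * (τ / ρ) * (w * K) * S)) ≤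
      w * (2 / α * (ξ * τ / (ε ^ 2 * ρ)) + K / (α * τ)) := by
    have h := mul_le_mul_of_nonneg_left hS
      (by positivity : 0 ≤ 1 / (2 * n * ε ^ 2) * (2 / (α * K) * (τ / ρ) * (w * K)))
    have e : 1 / (2 * n * ε ^ 2) * (2 / (α * K) * (τ / ρ) * (w * K)) *
        -(2 * n * (ξ + K * (ε ^ 2 * ρ / τ ^ 2) / 2)) =
        -(w * (2 / α * (ξ * τ / (ε ^ 2 * ρ)) + K / (α * τ))) := by
      field_simp
    rw [e] at h
    linarith
  have hsq : 0 ≤ w * (2 * K / α * (ξ ^ 2 * τ / (ε ^ 2 * ρ))) := by positivity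
  have hmain : w / (α * τ) * (-c * (1 + K * ξ) + α * c * (K * ξ) + α * K + K) ≤ 0 := by
    refine mul_nonpos_of_nonneg_of_nonpos (by positivity) ?_
    have hc0 : 0 < c := by linarith
    have h1 : -((1 - α) * (K * ξ)) ≤ 1 / 2 := by
      have := (abs_le.1 hξ).1
      nlinarith
    have h2 := mul_le_mul_of_nonneg_left h1 hc0.le
    nlinarith [mul_le_mul_of_nonneg_right hα1 hK.le]
  have e : w * (-(c / α) / τ * (1 + K * ξ) + K * (c * ξ / τ)) +
      1 / ε * (w * (-(2 / α) * (ξ * τ / ε / ρ) * (1 + K * ξ) + K * (ε / τ))) +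
      w * (2 / α * (ξ * τ / (ε ^ 2 * ρ)) + K / (α * τ)) =
      w / (α * τ) * (-c * (1 + K * ξ) + α * c * (K * ξ) + α * K + K) -
      w * (2 * K / α * (ξ ^ 2 * τ / (ε ^ 2 * ρ))) := by
    field_simp
    ring
  linarith

lemma hasDerivAt_rpow_time {A c T ρ p b t : ℝ} (hρ : 0 < ρ) (hτ : 0 < T - c * t) :
    HasDerivAt (fun s => A * ((T - c * s) / ρ) ^ p * (1 + b / (T - c * s)))
      (A * ((T - c * t) / ρ) ^ p * (-(c * p) / (T - c * t) * (1 + b / (T - c * t)) +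
        c * (b / (T - c * t)) / (T - c * t))) t := by
  have hτ' : HasDerivAt (fun s => T - c * s) (-c) t := by
    simpa using ((hasDerivAt_id t).const_mul c).const_sub T
  have hpow := ((hτ'.div_const ρ).rpow_const (p := p) (Or.inl (by positivity))).const_mul A
  have hlin := ((hasDerivAt_const t b).div hτ' hτ.ne').const_add 1
  refine (hpow.mul hlin).congr_deriv ?_
  simp only [Pi.div_apply]
  rw [Real.rpow_sub_one (by positivity)]
  field_simp
  ring

lemma hasFDerivAt_rpow_space {E : Type*} [NormedAddCommGroup E] [InnerProductSpace ℝ E]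
    {A τ r p b : ℝ} (hr : 0 < r) (hτ : 0 < τ) (v x : E) :
    ∃ L : E →L[ℝ] ℝ,
      HasFDerivAt (fun y => A * (τ / (‖y‖ ^ 2 + r)) ^ p * (1 + b * ⟪v, y⟫_ℝ)) L x ∧
      L v = A * (τ / (‖x‖ ^ 2 + r)) ^ p *
        (-(2 * p) * (⟪v, x⟫_ℝ / (‖x‖ ^ 2 + r)) * (1 + b * ⟪v, x⟫_ℝ) + b * ‖v‖ ^ 2) := by
  have hρ : 0 < ‖x‖ ^ 2 + r := by positivity
  have h1 : HasFDerivAt (fun y : E => ‖y‖ ^ 2 + r) (2 • innerSL ℝ x) x :=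
    (hasStrictFDerivAt_norm_sq x).hasFDerivAt.add_const r
  have hd : HasDerivAt (fun z : ℝ => A * (τ / z) ^ p)
      (A * (-τ / (‖x‖ ^ 2 + r) ^ 2 * p * (τ / (‖x‖ ^ 2 + r)) ^ (p - 1))) (‖x‖ ^ 2 + r) := by
    have h := (((hasDerivAt_const (‖x‖ ^ 2 + r) τ).div (hasDerivAt_id _) hρ.ne').rpow_const
      (p := p) (Or.inl (div_pos hτ hρ).ne')).const_mul A
    refine h.congr_deriv ?_
    simp [id]
  have h2 := hd.comp_hasFDerivAt x h1
  have h3 : HasFDerivAt (fun y : E => 1 + b * ⟪v, y⟫_ℝ) (b • innerSL ℝ v) x :=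
    (((innerSL ℝ v).hasFDerivAt (x := x)).const_mul b).const_add 1
  refine ⟨_, h2.mul h3, ?_⟩
  simp only [add_apply, smul_apply, innerSL_apply_apply,
    smul_eq_mul, nsmul_eq_mul, Function.comp, real_inner_self_eq_norm_sq,
    real_inner_comm v x]
  rw [Real.rpow_sub_one (by positivity)]
  field_simp
  push_cast
  ring

/-- Existence of a family of local smooth subsolutions of the scaled Carleman
kinetic system with interaction `k_α(a,b) = (a+b)^α`, `n ≥ 3`,
`α ∈ (2/n, 1]`: there exist constants `c > 1` and `c̄ > 0`, depending only on
`n` and `α`, such that for all `ε, R, T > 0` there is a family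
`ū_1^ε, …, ū_{2n}^ε`, smooth on the region
`S = {(x,t) : ε(|x|²+R²)^{1/2} < c̄(T−ct), 0 ≤ t < T/c}`, which is a classical
subsolution on `S` and satisfies `(1/(4n))Ψ ≤ ū_i^ε ≤ (3/(4n))Ψ` on `S`,
where `Ψ(x,t) = C_α ((T−ct)/(|x|²+R²))^{1/α}`, `C_α^α = 2n^{α−1}(n−2/α)`. -/
theorem exists_local_subsolution_family (n : ℕ) (hn : 3 ≤ n) (α : ℝ)
    (hα : 2 / (n : ℝ) < α ∧ α ≤ 1) :
    ∃ c > (1 : ℝ), ∃ cb > (0 : ℝ), ∀ (ε R T : ℝ), 0 < ε → 0 < R → 0 < T →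
      ∀ Cα : ℝ, 0 < Cα →
      Cα ^ α = 2 * (n : ℝ) ^ (α - 1) * ((n : ℝ) - 2 / α) →
      ∀ Ψ : EuclideanSpace ℝ (Fin n) → ℝ → ℝ,
      (∀ x s, Ψ x s = Cα * ((T - c * s) / (‖x‖ ^ 2 + R ^ 2)) ^ (1 / α)) →
      ∃ u : (Fin n ⊕ Fin n) → EuclideanSpace ℝ (Fin n) → ℝ → ℝ,
        (∀ i, ContDiffOn ℝ (⊤ : ℕ∞) (fun p : EuclideanSpace ℝ (Fin n) × ℝ => u i p.1 p.2)
          {p : EuclideanSpace ℝ (Fin n) × ℝ |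
            ε * (‖p.1‖ ^ 2 + R ^ 2) ^ ((1 : ℝ) / 2) < cb * (T - c * p.2) ∧
            0 ≤ p.2 ∧ p.2 < T / c}) ∧
        ∀ (x : EuclideanSpace ℝ (Fin n)) (t : ℝ),
          ε * (‖x‖ ^ 2 + R ^ 2) ^ ((1 : ℝ) / 2) < cb * (T - c * t) →
          0 ≤ t → t < T / c → ∀ i,
            (deriv (fun s => u i x s) t +
              (1 / ε) * fderiv ℝ (fun y => u i y t) x (vel i) -
              (1 / (2 * (n : ℝ) * ε ^ 2)) *
                ∑ j, (u i x t + u j x t) ^ α * (u j x t - u i x t) ≤ 0) ∧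
            (1 / (4 * (n : ℝ))) * Ψ x t ≤ u i x t ∧
            u i x t ≤ (3 / (4 * (n : ℝ))) * Ψ x t := by
  obtain ⟨hα2, hα1⟩ := hα
  have hn0 : (0 : ℝ) < n := by
    have : 0 < n := by omega
    exact_mod_cast this
  have hα0 : 0 < α := lt_trans (by positivity) hα2
  have hαn : 0 < α * n - 2 := by
    rw [div_lt_iff₀ hn0] at hα2
    linarith
  obtain ⟨K, hKdef⟩ : ∃ K : ℝ, K = n / (α * n - 2) := ⟨_, rfl⟩
  have hK : 0 < K := hKdef ▸ by positivity
  refine ⟨2 + 4 * K, by linarith, 1 / (2 * K), by positivity, ?_⟩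
  intro ε R T hε hR hT Cα hC hCα Ψ hΨ
  have hc : 4 * K ≤ 2 + 4 * K := by linarith
  have hc0 : 0 < 2 + 4 * K := by linarith
  generalize 2 + 4 * K = c at hc hc0 hΨ ⊢
  refine ⟨fun i x s => Cα / (2 * n) * ((T - c * s) / (‖x‖ ^ 2 + R ^ 2)) ^ (1 / α) *
    (1 + K * ε * ⟪vel i, x⟫_ℝ / (T - c * s)), ?_, ?_⟩
  · rintro i ⟨x, t⟩ ⟨-, -, ht⟩
    have hτ : 0 < T - c * t := by
      rw [lt_div_iff₀ hc0] at ht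
      linarith
    have hρ : 0 < ‖x‖ ^ 2 + R ^ 2 := by positivity
    have hτs : ContDiffAt ℝ (⊤ : ℕ∞)
        (fun p : EuclideanSpace ℝ (Fin n) × ℝ => T - c * p.2) (x, t) := by fun_prop
    have hρs : ContDiffAt ℝ (⊤ : ℕ∞)
        (fun p : EuclideanSpace ℝ (Fin n) × ℝ => ‖p.1‖ ^ 2 + R ^ 2) (x, t) :=
      ((contDiff_norm_sq ℝ).comp contDiff_fst).contDiffAt.add contDiffAt_const
    have hvs : ContDiffAt ℝ (⊤ : ℕ∞)
        (fun p : EuclideanSpace ℝ (Fin n) × ℝ => K * ε * ⟪vel i, p.1⟫_ℝ) (x, t) :=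
      contDiffAt_const.mul (contDiffAt_const.inner ℝ contDiffAt_fst)
    exact ((contDiffAt_const.mul ((hτs.div hρs hρ.ne').rpow_const_of_ne
      (div_pos hτ hρ).ne')).mul (contDiffAt_const.add (hvs.div hτs hτ.ne'))).contDiffWithinAt
  · intro x t hS _ ht i
    have hτ : 0 < T - c * t := by
      rw [lt_div_iff₀ hc0] at ht
      linarith
    have hρ : 0 < ‖x‖ ^ 2 + R ^ 2 := by positivity
    have htime := (hasDerivAt_rpow_time (A := Cα / (2 * n)) (p := 1 / α)
      (b := K * ε * ⟪vel i, x⟫_ℝ) hρ hτ).deriv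
    obtain ⟨L, hL, hLv⟩ := hasFDerivAt_rpow_space (A := Cα / (2 * n)) (p := 1 / α)
      (b := K * ε / (T - c * t)) (sq_pos_of_pos hR) hτ (vel i) x
    have hspace : fderiv ℝ (fun y => Cα / (2 * n) *
        ((T - c * t) / (‖y‖ ^ 2 + R ^ 2)) ^ (1 / α) *
        (1 + K * ε * ⟪vel i, y⟫_ℝ / (T - c * t))) x (vel i) = L (vel i) := by
      simp only [div_mul_eq_mul_div] at hL ⊢
      rw [hL.fderiv]
    simp only [hspace, htime, hLv, norm_vel, hΨ]
    obtain ⟨ξ, hξdef⟩ : ∃ ξ : Fin n ⊕ Fin n → ℝ,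
        ξ = fun j => ε * ⟪vel j, x⟫_ℝ / (T - c * t) := ⟨_, rfl⟩
    have hξ : ∀ j, ε * ⟪vel j, x⟫_ℝ / (T - c * t) = ξ j := fun j => by rw [hξdef]
    have hsum : ∑ j, ξ j = 0 := by
      simp only [hξdef, ← Finset.sum_div, ← Finset.mul_sum, sum_inner_vel, mul_zero, zero_div]
    have hin : ∀ j, ⟪vel j, x⟫_ℝ ^ 2 ≤ ‖x‖ ^ 2 + R ^ 2 := fun j => by
      have h : |⟪vel j, x⟫_ℝ| ≤ ‖x‖ := by
        simpa [norm_vel] using abs_real_inner_le_norm (vel j) x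
      have := sq_le_sq' (abs_le.1 h).1 (abs_le.1 h).2
      nlinarith [sq_nonneg R]
    rw [← Real.sqrt_eq_rpow] at hS
    have hcl : ∀ j, ξ j ^ 2 ≤ ε ^ 2 * (‖x‖ ^ 2 + R ^ 2) / (T - c * t) ^ 2 := fun j => by
      rw [← hξ j, div_pow, mul_pow]
      gcongr
      exact hin j
    have hKξ : ∀ j, |K * ξ j| ≤ 1 / 2 := fun j => by
      have h1 : |⟪vel j, x⟫_ℝ| ≤ √(‖x‖ ^ 2 + R ^ 2) := Real.abs_le_sqrt (hin j)
      rw [← hξ j, abs_mul, abs_div, abs_mul, abs_of_pos hK, abs_of_pos hε, abs_of_pos hτ]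
      have h2 : ε * |⟪vel j, x⟫_ℝ| / (T - c * t) ≤ 1 / (2 * K) := by
        rw [div_le_iff₀ hτ]
        exact (mul_le_mul_of_nonneg_left h1 hε.le).trans hS.le
      calc K * (ε * |⟪vel j, x⟫_ℝ| / (T - c * t)) ≤ K * (1 / (2 * K)) := by gcongr
        _ = 1 / 2 := by field_simp
    have hpert : ∀ j, K * ε * ⟪vel j, x⟫_ℝ / (T - c * t) = K * ξ j := fun j => by
      rw [← hξ j]; ring
    have hv : ⟪vel i, x⟫_ℝ = ξ i * (T - c * t) / ε := by
      rw [← hξ i]; field_simp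
    simp only [hpert]
    have hpert' : K * ε / (T - c * t) * ⟪vel i, x⟫_ℝ = K * ξ i := by rw [← hpert i]; ring
    rw [hpert', hv]
    generalize T - c * t = τ at *
    generalize ‖x‖ ^ 2 + R ^ 2 = ρ at *
    have hP : 0 < (τ / ρ) ^ (1 / α) := by positivity
    have hPα : ((τ / ρ) ^ (1 / α)) ^ α = τ / ρ := by
      rw [← Real.rpow_mul (by positivity), one_div_mul_cancel hα0.ne', Real.rpow_one]
    generalize (τ / ρ) ^ (1 / α) = P at *
    have hKi := abs_le.1 (hKξ i)
    refine ⟨?_, ?_, ?_⟩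
    · have hwα : (2 * (Cα / (2 * n) * P)) ^ α = 2 / (α * K) * (τ / ρ) := by
        have e : 2 * (Cα / (2 * n) * P) = Cα / n * P := by field_simp
        rw [e, Real.mul_rpow (by positivity) hP.le, Real.div_rpow hC.le hn0.le, hCα, hPα,
          Real.rpow_sub_one hn0.ne', hKdef]
        have : (0 : ℝ) < (n : ℝ) ^ α := by positivity
        field_simp
      have hw : 0 < Cα / (2 * n) * P := by positivity
      generalize Cα / (2 * n) * P = w at *
      have hterm : ∀ j, (w * (1 + K * ξ i) + w * (1 + K * ξ j)) ^ α *
          (w * (1 + K * ξ j) - w * (1 + K * ξ i)) =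
          2 / (α * K) * (τ / ρ) * (w * K) *
            ((1 + K * (ξ i + ξ j) / 2) ^ α * (ξ j - ξ i)) := fun j => by
        have hj := abs_le.1 (hKξ j)
        have e : w * (1 + K * ξ i) + w * (1 + K * ξ j) =
            2 * w * (1 + K * (ξ i + ξ j) / 2) := by ring
        rw [e, Real.mul_rpow (by positivity) (by linarith), hwα]
        ring
      simp only [hterm, ← Finset.mul_sum]
      have hcoll := collision_sum_ge hα0.le hα1 hK.le hsum hcl
        (fun j => (hKξ j).trans (by norm_num)) i
      have hcard : (Fintype.card (Fin n ⊕ Fin n) : ℝ) = 2 * n := by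
        simp [two_mul]
      rw [hcard] at hcoll
      refine le_of_eq_of_le ?_
        (kinetic_residual_nonpos hα0 hα1 hK hε hτ hρ hw hn0 hc (hKξ i) hcoll)
      ring
    · have e : 1 / (4 * (n : ℝ)) * (Cα * P) = Cα / (2 * n) * P * (1 / 2) := by
        field_simp
        norm_num
      rw [e]
      gcongr
      linarith
    · have e : 3 / (4 * (n : ℝ)) * (Cα * P) = Cα / (2 * n) * P * (3 / 2) := by
        field_simp
        norm_num
      rw [e]
      gcongr
      linarith
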